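/- Let Θ be a real symmetric positive definite 3×3 matrix, let T = (trace Θ)/3, let ν ∈ [-1/2, 1), and set C̃_ν = ν²(5−2ν)/3. Then det((1−ν)T·I + νΘ) ≥ (det Θ)^{C̃_ν} · T^{3(1−C̃_ν)}, where I is the 3×3 identity matrix. -/

import Mathlib

lemma slope_polynomial_nonneg {ν a r : ℝ} (hν1 : -1/2 ≤ ν) (hν2 : ν < 1)
    (ha0 : 0 ≤ a) (ha1 : a ≤ 1) (hr1 : -(2 * a^3) ≤ r) (hr2 : r ≤ 2 * a^3) :
    0 ≤ 4 * (3 * a^2) - 15 * r + (6 + 6*ν - 4*ν^2) * (3 * a^2)^2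
      - (6 + 15*ν - 4*ν^3) * (3 * a^2) * r + 3*ν*(3 + 3*ν - 2*ν^2) * r^2 := by
  have hquad : 0 ≤ 2 - (3 - 2*ν) * a + (6 + 6*ν - 4*ν^2) * a^2 := by
    have hdisc : 0 ≤ 8 * (6 + 6*ν - 4*ν^2) - (3 - 2*ν)^2 := by nlinarith
    nlinarith [sq_nonneg (4 - (3 - 2*ν) * a), mul_nonneg hdisc (sq_nonneg a)]
  have hνa : 0 ≤ 1 - ν * a := by nlinarith
  have hdouble : 0 ≤ 6 * a^2 * (1 - a) * (1 - ν * a)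
      * (2 - (3 - 2*ν) * a + (6 + 6*ν - 4*ν^2) * a^2) := by
    have : 0 ≤ 1 - a := by linarith
    positivity
  have ha2 : a^2 ≤ 1 := by nlinarith
  have ha3 : a^3 ≤ a^2 := by nlinarith [sq_nonneg a]
  have hc : 0 ≤ 3 + 3*ν - 2*ν^2 := by nlinarith
  have hslope : 0 ≤ 15 + (6 + 15*ν - 4*ν^3) * (3 * a^2)
      - 3*ν*(3 + 3*ν - 2*ν^2) * (r + 2 * a^3) := by
    rcases le_total 0 ν with h | h
    · have h1 : 3*ν*(3 + 3*ν - 2*ν^2) * (r + 2 * a^3)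
          ≤ 3*ν*(3 + 3*ν - 2*ν^2) * (4 * a^2) := by
        apply mul_le_mul_of_nonneg_left _ (by positivity)
        linarith
      have h2 : -15 ≤ 18 + 9*ν - 36*ν^2 + 12*ν^3 := by
        nlinarith [pow_nonneg h 3]
      nlinarith [mul_nonneg (by linarith : 0 ≤ 18 + 9*ν - 36*ν^2 + 12*ν^3 + 15) (sq_nonneg a)]
    · have h1 : 0 ≤ (-ν) * (3 + 3*ν - 2*ν^2) * (r + 2 * a^3) :=
        mul_nonneg (mul_nonneg (by linarith) hc) (by linarith)
      have h2 : -2 ≤ 6 + 15*ν - 4*ν^3 := by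
        nlinarith [pow_nonneg (neg_nonneg.mpr h) 3]
      nlinarith [mul_nonneg (by linarith : 0 ≤ 6 + 15*ν - 4*ν^3 + 2) (sq_nonneg a)]
  have := mul_nonneg (by linarith : 0 ≤ 2 * a^3 - r) hslope
  linear_combination hdouble + this

lemma logDeriv_inequality {ν x y z : ℝ} (hν1 : -1/2 ≤ ν) (hν2 : ν < 1) (hsum : x + y + z = 0)
    (hx : 0 < 1 + x) (hy : 0 < 1 + y) (hz : 0 < 1 + z) :
    (5 - 2*ν) * (2 * (x*y + y*z + z*x) + 3 * (x*y*z))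
        * (1 + ν^2 * (x*y + y*z + z*x) + ν^3 * (x*y*z))
      ≤ 3 * (2 * (x*y + y*z + z*x) + 3 * ν * (x*y*z))
        * (1 + (x*y + y*z + z*x) + x*y*z) := by
  obtain ⟨q, hq⟩ : ∃ q, q = -(x*y + y*z + z*x) := ⟨_, rfl⟩
  obtain ⟨r, hr⟩ : ∃ r, r = x*y*z := ⟨_, rfl⟩
  have hz' : z = -x - y := by linarith
  have hq0 : 0 ≤ q := by subst hz'; nlinarith [sq_nonneg (x + y), sq_nonneg x, sq_nonneg y]
  have hq3 : q ≤ 3 := by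
    nlinarith [mul_pos hx hy, mul_pos hy hz, mul_pos hz hx]
  have hdisc : 27 * r^2 ≤ 4 * q^3 := by
    subst hz' hq hr
    linear_combination sq_nonneg ((x - y) * (y - (-x - y)) * ((-x - y) - x))
  have hs := Real.sq_sqrt (by positivity : 0 ≤ q / 3)
  have ha0 := Real.sqrt_nonneg (q / 3)
  set a := √(q / 3)
  have hqa : q = 3 * a^2 := by linarith
  have ha1 : a ≤ 1 := by nlinarith
  have hra : r^2 ≤ (2 * a^3)^2 := by rw [hqa] at hdisc; nlinarith
  have habs := abs_le_of_sq_le_sq' hra (by positivity)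
  have hpoly := slope_polynomial_nonneg hν1 hν2 ha0 ha1 habs.1 habs.2
  rw [← hqa] at hpoly
  have hfac := mul_nonneg (by linarith : 0 ≤ 1 - ν) hpoly
  have he : x*y + y*z + z*x = -q := by linarith
  rw [he, ← hr]
  linear_combination hfac

lemma one_add_mul_pos {ν x y z : ℝ} (hν1 : -1/2 ≤ ν) (hν2 : ν < 1) (hsum : x + y + z = 0)
    (hx : 0 < 1 + x) (hy : 0 < 1 + y) (hz : 0 < 1 + z) : 0 < 1 + ν * x := by
  rcases le_total 0 ν with h | h
  · nlinarith [mul_nonneg h hx.le]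
  · nlinarith

lemma prod_one_add_mul {ν x y z : ℝ} (hsum : x + y + z = 0) :
    (1 + ν * x) * (1 + ν * y) * (1 + ν * z)
      = 1 + ν^2 * (x*y + y*z + z*x) + ν^3 * (x*y*z) := by
  linear_combination ν * hsum

lemma prod_one_add_mul_pos {ν x y z : ℝ} (hν1 : -1/2 ≤ ν) (hν2 : ν < 1) (hsum : x + y + z = 0)
    (hx : 0 < 1 + x) (hy : 0 < 1 + y) (hz : 0 < 1 + z) :
    0 < 1 + ν^2 * (x*y + y*z + z*x) + ν^3 * (x*y*z) := by
  rw [← prod_one_add_mul hsum]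
  exact mul_pos (mul_pos (one_add_mul_pos hν1 hν2 hsum hx hy hz)
    (one_add_mul_pos hν1 hν2 (by linarith) hy hz hx))
    (one_add_mul_pos hν1 hν2 (by linarith) hz hx hy)

lemma log_prod_one_add_mul_ge {ν x y z : ℝ} (hν1 : -1/2 ≤ ν) (hν2 : ν < 1)
    (hsum : x + y + z = 0) (hx : 0 < 1 + x) (hy : 0 < 1 + y) (hz : 0 < 1 + z) :
    (ν^2 * (5 - 2*ν) / 3) * Real.log (1 + (x*y + y*z + z*x) + x*y*z)
      ≤ Real.log (1 + ν^2 * (x*y + y*z + z*x) + ν^3 * (x*y*z)) := by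
  obtain ⟨e₂, he₂⟩ : ∃ e, e = x*y + y*z + z*x := ⟨_, rfl⟩
  obtain ⟨e₃, he₃⟩ : ∃ e, e = x*y*z := ⟨_, rfl⟩
  rw [← he₂, ← he₃]
  have hscale : ∀ s ∈ Set.Icc (0:ℝ) 1, s*x + s*y + s*z = 0 ∧
      0 < 1 + s*x ∧ 0 < 1 + s*y ∧ 0 < 1 + s*z := by
    rintro s ⟨h0, h1⟩
    have haux : ∀ t : ℝ, 0 < 1 + t → 0 < 1 + s*t := fun t ht => by
      rcases h0.eq_or_lt with rfl | h0
      · simp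
      · nlinarith [mul_pos h0 ht]
    exact ⟨by linear_combination s * hsum, haux x hx, haux y hy, haux z hz⟩
  have hA : ∀ s ∈ Set.Icc (0:ℝ) 1, 0 < 1 + ν^2 * e₂ * s^2 + ν^3 * e₃ * s^3 := by
    intro s hs
    obtain ⟨h, h1, h2, h3⟩ := hscale s hs
    have := prod_one_add_mul_pos hν1 hν2 h h1 h2 h3
    subst he₂ he₃
    linear_combination this
  have hB : ∀ s ∈ Set.Icc (0:ℝ) 1, 0 < 1 + e₂ * s^2 + e₃ * s^3 := by
    intro s hs
    obtain ⟨h, h1, h2, h3⟩ := hscale s hs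
    have := mul_pos (mul_pos h1 h2) h3
    subst he₂ he₃
    linear_combination this + s * hsum
  let f : ℝ → ℝ := fun s => Real.log (1 + ν^2 * e₂ * s^2 + ν^3 * e₃ * s^3)
    - (ν^2 * (5 - 2*ν) / 3) * Real.log (1 + e₂ * s^2 + e₃ * s^3)
  have hpoly : ∀ b c s : ℝ, HasDerivAt (fun s : ℝ => 1 + b * s^2 + c * s^3)
      (2 * b * s + 3 * c * s^2) s := by
    intro b c s
    refine ((((hasDerivAt_pow 2 s).const_mul b).const_add 1).add
      ((hasDerivAt_pow 3 s).const_mul c)).congr_deriv ?_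
    push_cast
    ring
  have hderiv : ∀ s ∈ Set.Icc (0:ℝ) 1, HasDerivAt f
      ((2 * (ν^2 * e₂) * s + 3 * (ν^3 * e₃) * s^2) / (1 + ν^2 * e₂ * s^2 + ν^3 * e₃ * s^3)
        - (ν^2 * (5 - 2*ν) / 3) * ((2 * e₂ * s + 3 * e₃ * s^2) / (1 + e₂ * s^2 + e₃ * s^3))) s :=
    fun s hs => ((hpoly _ _ s).log (hA s hs).ne').sub
      (((hpoly _ _ s).log (hB s hs).ne').const_mul _)
  have hmono : MonotoneOn f (Set.Icc 0 1) := by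
    apply monotoneOn_of_deriv_nonneg (convex_Icc 0 1)
    · exact fun s hs => (hderiv s hs).continuousAt.continuousWithinAt
    · exact fun s hs => (hderiv s (interior_subset hs)).differentiableAt.differentiableWithinAt
    · intro s hs
      rw [(hderiv s (interior_subset hs)).deriv]
      have hs' := interior_subset hs
      have hs0 : 0 < s := by rw [interior_Icc] at hs; exact hs.1
      obtain ⟨h, h1, h2, h3⟩ := hscale s hs'
      have hmain := logDeriv_inequality hν1 hν2 h h1 h2 h3
      have hA' := hA s hs'
      have hB' := hB s hs'
      have e1 : s*x*(s*y) + s*y*(s*z) + s*z*(s*x) = e₂ * s^2 := by rw [he₂]; ring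
      have e2 : s*x*(s*y)*(s*z) = e₃ * s^3 := by rw [he₃]; ring
      rw [e1, e2] at hmain
      have hform : (2 * (ν^2 * e₂) * s + 3 * (ν^3 * e₃) * s^2)
            / (1 + ν^2 * e₂ * s^2 + ν^3 * e₃ * s^3)
          - (ν^2 * (5 - 2*ν) / 3) * ((2 * e₂ * s + 3 * e₃ * s^2) / (1 + e₂ * s^2 + e₃ * s^3))
          = ν^2 * (3 * (2 * (e₂ * s^2) + 3 * ν * (e₃ * s^3)) * (1 + e₂ * s^2 + e₃ * s^3)
            - (5 - 2*ν) * (2 * (e₂ * s^2) + 3 * (e₃ * s^3))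
              * (1 + ν^2 * (e₂ * s^2) + ν^3 * (e₃ * s^3)))
            / (3 * s * (1 + ν^2 * e₂ * s^2 + ν^3 * e₃ * s^3) * (1 + e₂ * s^2 + e₃ * s^3)) := by
        have hA'' := hA'.ne'
        have hB'' := hB'.ne'
        rw [mul_div_assoc', div_sub_div _ _ hA'' hB'', div_eq_div_iff (by positivity)
          (by positivity)]
        ring
      rw [hform]
      exact div_nonneg (mul_nonneg (sq_nonneg ν) (by linarith)) (by positivity)
  have h01 := hmono (Set.left_mem_Icc.mpr zero_le_one) (Set.right_mem_Icc.mpr zero_le_one)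
    zero_le_one
  simp only [f] at h01
  norm_num at h01
  linarith

lemma prod_one_add_rpow_le {ν x y z : ℝ} (hν1 : -1/2 ≤ ν) (hν2 : ν < 1)
    (hsum : x + y + z = 0) (hx : 0 < 1 + x) (hy : 0 < 1 + y) (hz : 0 < 1 + z) :
    ((1 + x) * (1 + y) * (1 + z)) ^ (ν^2 * (5 - 2*ν) / 3)
      ≤ (1 + ν * x) * (1 + ν * y) * (1 + ν * z) := by
  have hp : (1 + x) * (1 + y) * (1 + z) = 1 + (x*y + y*z + z*x) + x*y*z := by
    linear_combination hsum
  have hpos : 0 < (1 + x) * (1 + y) * (1 + z) := by positivity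
  have hlog := log_prod_one_add_mul_ge hν1 hν2 hsum hx hy hz
  rw [← hp] at hlog
  rw [prod_one_add_mul hsum, Real.rpow_def_of_pos hpos, mul_comm,
    ← Real.le_log_iff_exp_le (prod_one_add_mul_pos hν1 hν2 hsum hx hy hz)]
  exact hlog

lemma prod_rpow_mul_mean_rpow_le {ν T a b c : ℝ} (hν1 : -1/2 ≤ ν) (hν2 : ν < 1)
    (ha : 0 < a) (hb : 0 < b) (hc : 0 < c) (hT : a + b + c = 3 * T) :
    (a * b * c) ^ (ν^2 * (5 - 2*ν) / 3) * T ^ (3 * (1 - ν^2 * (5 - 2*ν) / 3))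
      ≤ ((1-ν) * T + ν * a) * ((1-ν) * T + ν * b) * ((1-ν) * T + ν * c) := by
  have hT0 : 0 < T := by linarith
  have hadd : ∀ t : ℝ, 1 + (t / T - 1) = t / T := fun t => by ring
  have hfac : ∀ t : ℝ, (1-ν) * T + ν * t = T * (1 + ν * (t / T - 1)) := fun t => by
    field_simp
    ring
  have hmain := prod_one_add_rpow_le (x := a / T - 1) (y := b / T - 1) (z := c / T - 1) hν1 hν2
    (by field_simp; linarith) (by rw [hadd]; positivity) (by rw [hadd]; positivity)
    (by rw [hadd]; positivity)
  rw [hadd, hadd, hadd] at hmain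
  have habc : a * b * c = T^3 * (a / T * (b / T) * (c / T)) := by field_simp
  have hleft : (a * b * c) ^ (ν^2 * (5 - 2*ν) / 3) * T ^ (3 * (1 - ν^2 * (5 - 2*ν) / 3))
      = T^3 * (a / T * (b / T) * (c / T)) ^ (ν^2 * (5 - 2*ν) / 3) := by
    rw [habc, Real.mul_rpow (by positivity) (by positivity), ← Real.rpow_natCast_mul hT0.le,
      mul_right_comm, ← Real.rpow_add hT0, ← Real.rpow_natCast T 3]
    congr 2
    push_cast
    ring
  rw [hleft, hfac, hfac, hfac]
  calc _ ≤ T^3 * _ := mul_le_mul_of_nonneg_left hmain (by positivity)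
    _ = _ := by ring

theorem stmt_8 (Θ : Matrix (Fin 3) (Fin 3) ℝ) (hΘ : Θ.PosDef) (ν : ℝ)
    (hν1 : -1/2 ≤ ν) (hν2 : ν < 1) :
    (((1-ν) * (Θ.trace / 3)) • (1 : Matrix (Fin 3) (Fin 3) ℝ) + ν • Θ).det
      ≥ Θ.det ^ (ν^2 * (5 - 2*ν) / 3)
        * (Θ.trace / 3) ^ (3 * (1 - ν^2 * (5 - 2*ν) / 3)) := by
  have hdet : Θ.det = ∏ i, hΘ.1.eigenvalues i := by simpa using hΘ.1.det_eq_prod_eigenvalues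
  have htr : Θ.trace = ∑ i, hΘ.1.eigenvalues i := by simpa using hΘ.1.trace_eq_sum_eigenvalues
  have hchar := congrArg (Polynomial.eval 1) hΘ.1.charpoly_eq
  rw [Matrix.eval_charpoly, Polynomial.eval_prod] at hchar
  have h0 := hΘ.eigenvalues_pos 0
  have h1 := hΘ.eigenvalues_pos 1
  have h2 := hΘ.eigenvalues_pos 2
  simp only [Fin.prod_univ_three, Fin.sum_univ_three] at hdet htr hchar
  generalize hΘ.1.eigenvalues 0 = a at *
  generalize hΘ.1.eigenvalues 1 = b at *
  generalize hΘ.1.eigenvalues 2 = c at *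
  have hmain := prod_rpow_mul_mean_rpow_le (T := Θ.trace / 3) hν1 hν2 h0 h1 h2 (by linarith)
  rw [← hdet] at hmain
  refine hmain.trans_eq ?_
  generalize Θ.trace / 3 = T at *
  simp [Matrix.det_fin_three, Matrix.trace_fin_three] at hdet htr hchar ⊢
  linear_combination (-(ν * ((1-ν) * T)^2)) * htr - ν^2 * ((1-ν) * T) * (hchar + htr + hdet)
    - ν^3 * hdet
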